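/- Let μ be the Haar probability measure on the unitary group U(d), φ ∈ ℂ^d a fixed unit vector, and V a d×d complex unitary matrix. Then ∫_{U(d)} |⟨Uφ, V(Uφ)⟩| dμ(U) ≥ max(1 − ‖V − I‖_F²/(2d), 0), where ‖·‖_F is the Frobenius norm. (Paper's Lemma 2, average fidelity lower bound.) -/

import Mathlib

open MeasureTheory
open scoped InnerProductSpace Matrix

/-- The Frobenius norm `‖A‖_F = √(Tr (Aᴴ A))` of a complex matrix. -/
noncomputable def frobeniusNorm {m : Type*} [Fintype m] (A : Matrix m m ℂ) : ℝ :=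
  Real.sqrt (Matrix.trace (Aᴴ * A)).re

open scoped ComplexOrder in
lemma frobeniusNorm_sub_one_sq {d : ℕ} (V : Matrix (Fin d) (Fin d) ℂ)
    (hV : V ∈ Matrix.unitaryGroup (Fin d) ℂ) :
    frobeniusNorm (V - 1) ^ 2 = 2 * d - 2 * V.trace.re := by
  have h : Vᴴ * V = 1 := Matrix.mem_unitaryGroup_iff'.1 hV
  have hnn : 0 ≤ ((V - 1)ᴴ * (V - 1)).trace.re :=
    (Complex.nonneg_iff.1 (Matrix.posSemidef_conjTranspose_mul_self (V - 1)).trace_nonneg).1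
  rw [frobeniusNorm, Real.sq_sqrt hnn, Matrix.conjTranspose_sub,
    Matrix.conjTranspose_one, sub_mul, mul_sub, h]
  simp [Matrix.trace_conjTranspose, Matrix.trace_sub]
  ring

lemma diagonal_neg_one_mem_unitaryGroup {d : ℕ} (i : Fin d) :
    Matrix.diagonal (fun k => if k = i then (-1 : ℂ) else 1) ∈ Matrix.unitaryGroup (Fin d) ℂ := by
  rw [Matrix.mem_unitaryGroup_iff, Matrix.star_eq_conjTranspose, Matrix.diagonal_conjTranspose,
    Matrix.diagonal_mul_diagonal, ← Matrix.diagonal_one]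
  congr 1
  ext k
  by_cases h : k = i <;> simp [h]

lemma permMatrix_mem_unitaryGroup {d : ℕ} (σ : Equiv.Perm (Fin d)) :
    σ.permMatrix ℂ ∈ Matrix.unitaryGroup (Fin d) ℂ := by
  rw [Matrix.mem_unitaryGroup_iff, Matrix.star_eq_conjTranspose, Matrix.conjTranspose_permMatrix,
    ← Matrix.permMatrix_mul]
  simp

lemma star_mulVec_dotProduct_mulVec_of_mem_unitaryGroup {d : ℕ} {U : Matrix (Fin d) (Fin d) ℂ}
    (hU : U ∈ Matrix.unitaryGroup (Fin d) ℂ) (v : Fin d → ℂ) :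
    star (U *ᵥ v) ⬝ᵥ (U *ᵥ v) = star v ⬝ᵥ v := by
  have h : Uᴴ * U = 1 := Matrix.mem_unitaryGroup_iff'.1 hU
  rw [Matrix.star_mulVec, ← Matrix.dotProduct_mulVec, Matrix.mulVec_mulVec, h, Matrix.one_mulVec]

section HaarMoments

variable {d : ℕ} [MeasurableSpace (Matrix.unitaryGroup (Fin d) ℂ)]
  [BorelSpace (Matrix.unitaryGroup (Fin d) ℂ)] (μ : Measure (Matrix.unitaryGroup (Fin d) ℂ))

/-- The matrix coefficient `conj (U v)ᵢ * (U v)ⱼ` is integrable for a finite measure. -/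
lemma integrable_star_mulVec_mul_mulVec [IsFiniteMeasure μ] (v : Fin d → ℂ) (i j : Fin d) :
    Integrable (fun U : Matrix.unitaryGroup (Fin d) ℂ =>
      star ((U.1 *ᵥ v) i) * (U.1 *ᵥ v) j) μ := by
  have hc : ∀ k, Continuous fun U : Matrix.unitaryGroup (Fin d) ℂ => (U.1 *ᵥ v) k := fun k =>
    (continuous_apply k).comp (continuous_subtype_val.matrix_mulVec continuous_const)
  have hb : ∀ (U : Matrix.unitaryGroup (Fin d) ℂ) k, ‖(U.1 *ᵥ v) k‖ ≤ ∑ l, ‖v l‖ := by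
    intro U k
    rw [Matrix.mulVec, dotProduct]
    refine (norm_sum_le _ _).trans (Finset.sum_le_sum fun l _ => ?_)
    rw [norm_mul]
    exact mul_le_of_le_one_left (norm_nonneg _) (entry_norm_bound_of_unitary U.2 k l)
  refine Integrable.of_bound ((hc i).star.mul (hc j)).aestronglyMeasurable
    ((∑ l, ‖v l‖) * ∑ l, ‖v l‖) (Filter.Eventually.of_forall fun U => ?_)
  rw [norm_mul, norm_star]
  exact mul_le_mul (hb U i) (hb U j) (norm_nonneg _) (Finset.sum_nonneg fun _ _ => norm_nonneg _)

lemma integral_star_mulVec_mul_mulVec_translate [μ.IsMulLeftInvariant] (v : Fin d → ℂ)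
    (i j : Fin d) {W : Matrix (Fin d) (Fin d) ℂ} (hW : W ∈ Matrix.unitaryGroup (Fin d) ℂ) :
    ∫ U : Matrix.unitaryGroup (Fin d) ℂ,
        star ((W *ᵥ (U.1 *ᵥ v)) i) * (W *ᵥ (U.1 *ᵥ v)) j ∂μ =
      ∫ U : Matrix.unitaryGroup (Fin d) ℂ, star ((U.1 *ᵥ v) i) * (U.1 *ᵥ v) j ∂μ := by
  rw [← integral_mul_left_eq_self (μ := μ)
    (fun U : Matrix.unitaryGroup (Fin d) ℂ => star ((U.1 *ᵥ v) i) * (U.1 *ᵥ v) j) ⟨W, hW⟩]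
  simp only [Submonoid.coe_mul, Matrix.mulVec_mulVec]

lemma integral_star_mulVec_mul_mulVec_of_ne [μ.IsMulLeftInvariant] (v : Fin d → ℂ)
    {i j : Fin d} (hij : i ≠ j) :
    ∫ U : Matrix.unitaryGroup (Fin d) ℂ, star ((U.1 *ᵥ v) i) * (U.1 *ᵥ v) j ∂μ = 0 := by
  have h := integral_star_mulVec_mul_mulVec_translate μ v i j
    (diagonal_neg_one_mem_unitaryGroup i)
  simp only [Matrix.mulVec_diagonal, if_true, if_neg hij.symm, neg_mul, one_mul, star_neg,
    integral_neg] at h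
  exact self_eq_neg.1 h.symm

lemma integral_star_mulVec_mul_mulVec_self [μ.IsMulLeftInvariant] [IsProbabilityMeasure μ]
    (v : Fin d → ℂ) (hv : star v ⬝ᵥ v = 1) (i : Fin d) :
    ∫ U : Matrix.unitaryGroup (Fin d) ℂ, star ((U.1 *ᵥ v) i) * (U.1 *ᵥ v) i ∂μ = (d : ℂ)⁻¹ := by
  have hperm : ∀ j, ∫ U : Matrix.unitaryGroup (Fin d) ℂ,
        star ((U.1 *ᵥ v) j) * (U.1 *ᵥ v) j ∂μ =
      ∫ U : Matrix.unitaryGroup (Fin d) ℂ, star ((U.1 *ᵥ v) i) * (U.1 *ᵥ v) i ∂μ := by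
    intro j
    have h := integral_star_mulVec_mul_mulVec_translate μ v i i
      (permMatrix_mem_unitaryGroup (Equiv.swap i j))
    simpa only [Matrix.permMatrix_mulVec, Function.comp_apply, Equiv.swap_apply_left] using h
  have hsum : ∑ j, ∫ U : Matrix.unitaryGroup (Fin d) ℂ,
      star ((U.1 *ᵥ v) j) * (U.1 *ᵥ v) j ∂μ = 1 := by
    rw [← integral_finsetSum _ fun j _ => integrable_star_mulVec_mul_mulVec μ v j j]
    have h : ∀ U : Matrix.unitaryGroup (Fin d) ℂ,
        ∑ j, star ((U.1 *ᵥ v) j) * (U.1 *ᵥ v) j = 1 := fun U =>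
      (star_mulVec_dotProduct_mulVec_of_mem_unitaryGroup U.2 v).trans hv
    simp only [h, integral_const, probReal_univ, one_smul]
  rw [Finset.sum_congr rfl fun j _ => hperm j, Finset.sum_const, Finset.card_univ,
    Fintype.card_fin, nsmul_eq_mul] at hsum
  exact eq_inv_of_mul_eq_one_right hsum

/-- The Haar average of the expectation value of `V` in a random pure state is `Tr V / d`. -/
lemma integral_star_mulVec_dotProduct_mulVec [μ.IsMulLeftInvariant] [IsProbabilityMeasure μ]
    (v : Fin d → ℂ) (hv : star v ⬝ᵥ v = 1) (V : Matrix (Fin d) (Fin d) ℂ) :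
    ∫ U : Matrix.unitaryGroup (Fin d) ℂ, star (U.1 *ᵥ v) ⬝ᵥ (V *ᵥ (U.1 *ᵥ v)) ∂μ =
      V.trace / d := by
  have h : ∀ U : Matrix.unitaryGroup (Fin d) ℂ, star (U.1 *ᵥ v) ⬝ᵥ (V *ᵥ (U.1 *ᵥ v)) =
      ∑ i, ∑ j, V i j * (star ((U.1 *ᵥ v) i) * (U.1 *ᵥ v) j) := by
    intro U
    generalize U.1 *ᵥ v = x
    simp only [dotProduct, Matrix.mulVec, Finset.mul_sum, Pi.star_apply]
    exact Finset.sum_congr rfl fun i _ => Finset.sum_congr rfl fun j _ => by ring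
  have hint : ∀ i j, Integrable (fun U : Matrix.unitaryGroup (Fin d) ℂ =>
      V i j * (star ((U.1 *ᵥ v) i) * (U.1 *ᵥ v) j)) μ := fun i j =>
    (integrable_star_mulVec_mul_mulVec μ v i j).const_mul _
  simp only [h]
  rw [integral_finsetSum _ fun i _ => integrable_finsetSum _ fun j _ => hint i j, Matrix.trace,
    Finset.sum_div]
  refine Finset.sum_congr rfl fun i _ => ?_
  rw [integral_finsetSum _ fun j _ => hint i j, Finset.sum_eq_single i]
  · rw [integral_const_mul, integral_star_mulVec_mul_mulVec_self μ v hv, Matrix.diag_apply,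
      div_eq_mul_inv]
  · intro j _ hj
    rw [integral_const_mul, integral_star_mulVec_mul_mulVec_of_ne μ v hj.symm, mul_zero]
  · simp

end HaarMoments

/-- **Average fidelity lower bound** (paper's Lemma 2).
For the Haar probability measure `μ` on `U(d)`, a fixed unit vector `φ` and a unitary `V`,
`∫ |⟨Uφ, V (Uφ)⟩| dμ(U) ≥ max (1 - ‖V - I‖_F²/(2d)) 0`. -/
theorem average_fidelity_lower_bound {d : ℕ}
    [MeasurableSpace (Matrix.unitaryGroup (Fin d) ℂ)]
    [BorelSpace (Matrix.unitaryGroup (Fin d) ℂ)]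
    (μ : Measure (Matrix.unitaryGroup (Fin d) ℂ))
    [μ.IsHaarMeasure] [IsProbabilityMeasure μ]
    (φ : EuclideanSpace ℂ (Fin d)) (hφ : ‖φ‖ = 1)
    (V : Matrix (Fin d) (Fin d) ℂ) (hV : V ∈ Matrix.unitaryGroup (Fin d) ℂ) :
    max (1 - frobeniusNorm (V - 1) ^ 2 / (2 * d)) 0 ≤
      ∫ U : Matrix.unitaryGroup (Fin d) ℂ,
        ‖(⟪Matrix.toEuclideanLin (U : Matrix (Fin d) (Fin d) ℂ) φ,
            Matrix.toEuclideanLin V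
              (Matrix.toEuclideanLin (U : Matrix (Fin d) (Fin d) ℂ) φ)⟫_ℂ)‖ ∂μ := by
  have hd : (d : ℝ) ≠ 0 := by
    rintro h
    obtain rfl : d = 0 := by exact_mod_cast h
    simp [Subsingleton.elim φ 0] at hφ
  have hv : star φ.ofLp ⬝ᵥ φ.ofLp = 1 := by
    rw [dotProduct_comm, ← EuclideanSpace.inner_eq_star_dotProduct, inner_self_eq_norm_sq_to_K, hφ]
    simp
  have hinner : ∀ U : Matrix.unitaryGroup (Fin d) ℂ,
      ⟪Matrix.toEuclideanLin (U : Matrix (Fin d) (Fin d) ℂ) φ,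
        Matrix.toEuclideanLin V (Matrix.toEuclideanLin (U : Matrix (Fin d) (Fin d) ℂ) φ)⟫_ℂ =
      star (U.1 *ᵥ φ.ofLp) ⬝ᵥ (V *ᵥ (U.1 *ᵥ φ.ofLp)) := fun U => by
    rw [EuclideanSpace.inner_eq_star_dotProduct, dotProduct_comm]
    simp only [Matrix.ofLp_toLpLin, Matrix.toLin'_apply]
  refine max_le ?_ (integral_nonneg fun U => norm_nonneg _)
  simp only [hinner]
  calc 1 - frobeniusNorm (V - 1) ^ 2 / (2 * d) = (V.trace / d).re := by
        rw [frobeniusNorm_sub_one_sq V hV, Complex.div_natCast_re]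
        field_simp
        ring
    _ ≤ ‖V.trace / d‖ := Complex.re_le_norm _
    _ ≤ _ := by
        rw [← integral_star_mulVec_dotProduct_mulVec μ φ.ofLp hv V]
        exact norm_integral_le_integral_norm _
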